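/- Let u(t,x) = a·e^{iφ}·exp(-|x - (1/3)a²t|) with real constants a, φ. Then among oscillatory peakon profiles u = a·exp(i(φ+ωt+kx))·e^{-|x-ct|} with a ≠ 0, the weak-amplitude formulation of the Hirota-type peakon equation forces k = 0, ω = 0, and c = (1/3)a²; and with these values u is a weak-amplitude solution. -/

import Mathlib

open MeasureTheory

noncomputable section

def psix (ψ : ℝ × ℝ → ℝ) (p : ℝ × ℝ) : ℝ := deriv (fun y => ψ (p.1, y)) p.2
def psixx (ψ : ℝ × ℝ → ℝ) (p : ℝ × ℝ) : ℝ := deriv (fun y => psix ψ (p.1, y)) p.2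
def psit (ψ : ℝ × ℝ → ℝ) (p : ℝ × ℝ) : ℝ := deriv (fun s => ψ (s, p.2)) p.1

/-- Peakon amplitude A = a e^{-|x-ct|}. -/
def Apk (a c : ℝ) (p : ℝ × ℝ) : ℝ := a * Real.exp (-|p.2 - c * p.1|)

/-- a.e. x-derivative A_x = -a sgn(x-ct) e^{-|x-ct|}. -/
def Apkx (a c : ℝ) (p : ℝ × ℝ) : ℝ :=
  -a * Real.sign (p.2 - c * p.1) * Real.exp (-|p.2 - c * p.1|)

/-- a.e. t-derivative A_t = a c sgn(x-ct) e^{-|x-ct|}. -/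
def Apkt (a c : ℝ) (p : ℝ × ℝ) : ℝ :=
  a * c * Real.sign (p.2 - c * p.1) * Real.exp (-|p.2 - c * p.1|)

/-- Linear phase Φ = φ + ωt + kx. -/
def Phs (φ ω k : ℝ) (p : ℝ × ℝ) : ℝ := φ + ω * p.1 + k * p.2

/-- The even peakon weight `e^{-n|x-ct|}`. -/
def peakEven (c : ℝ) (n : ℕ) (p : ℝ × ℝ) : ℝ := Real.exp (-|p.2 - c * p.1|) ^ n

/-- The odd peakon weight `sgn(x-ct) e^{-n|x-ct|}`. -/
def peakOdd (c : ℝ) (n : ℕ) (p : ℝ × ℝ) : ℝ :=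
  Real.sign (p.2 - c * p.1) * Real.exp (-|p.2 - c * p.1|) ^ n

section Line

open Set

variable {g : ℝ → ℝ}

theorem integrable_mul_exp (hg : Continuous g) (hgc : HasCompactSupport g) (r y : ℝ) :
    Integrable fun x => g x * Real.exp (r * (x - y)) :=
  (hg.mul (by fun_prop)).integrable_of_hasCompactSupport hgc.mul_right

theorem deriv_mul_exp (hg : ContDiff ℝ 1 g) (r y : ℝ) :
    deriv (fun x => g x * Real.exp (r * (x - y))) =
      fun x => deriv g x * Real.exp (r * (x - y)) + r * (g x * Real.exp (r * (x - y))) := by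
  ext x
  have h1 := (hg.differentiable one_ne_zero x).hasDerivAt
  have h2 := (((hasDerivAt_id x).sub_const y).const_mul r).exp
  refine ((h1.mul h2).congr_deriv ?_).deriv
  simp only [id]
  ring

theorem integral_Ioi_deriv_mul_exp (hg : ContDiff ℝ 1 g) (hgc : HasCompactSupport g) (r y : ℝ) :
    ∫ x in Ioi y, deriv g x * Real.exp (r * (x - y)) =
      -g y - r * ∫ x in Ioi y, g x * Real.exp (r * (x - y)) := by
  have h := HasCompactSupport.integral_Ioi_deriv_eq
    (f := fun x => g x * Real.exp (r * (x - y))) (hg.mul (by fun_prop)) hgc.mul_right y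
  rw [deriv_mul_exp hg, integral_add
    (integrable_mul_exp (hg.continuous_deriv le_rfl) hgc.deriv r y).integrableOn
    ((integrable_mul_exp hg.continuous hgc r y).const_mul r).integrableOn,
    integral_const_mul] at h
  simp only [sub_self, mul_zero, Real.exp_zero, mul_one] at h
  linarith

theorem integral_Iic_deriv_mul_exp (hg : ContDiff ℝ 1 g) (hgc : HasCompactSupport g) (r y : ℝ) :
    ∫ x in Iic y, deriv g x * Real.exp (r * (x - y)) =
      g y - r * ∫ x in Iic y, g x * Real.exp (r * (x - y)) := by
  have h := HasCompactSupport.integral_Iic_deriv_eq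
    (f := fun x => g x * Real.exp (r * (x - y))) (hg.mul (by fun_prop)) hgc.mul_right y
  rw [deriv_mul_exp hg, integral_add
    (integrable_mul_exp (hg.continuous_deriv le_rfl) hgc.deriv r y).integrableOn
    ((integrable_mul_exp hg.continuous hgc r y).const_mul r).integrableOn,
    integral_const_mul] at h
  simp only [sub_self, mul_zero, Real.exp_zero, mul_one] at h
  linarith

theorem exp_neg_abs_pow_of_pos {z : ℝ} (hz : 0 < z) (n : ℕ) :
    Real.exp (-|z|) ^ n = Real.exp (-n * z) := by
  rw [← Real.exp_nat_mul, abs_of_pos hz]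
  ring_nf

theorem exp_neg_abs_pow_of_neg {z : ℝ} (hz : z < 0) (n : ℕ) :
    Real.exp (-|z|) ^ n = Real.exp (n * z) := by
  rw [← Real.exp_nat_mul, abs_of_neg hz]
  ring_nf

theorem integral_mul_peak_split {w : ℝ → ℝ} {n : ℕ} {y α β : ℝ}
    (hg : Continuous g) (hgc : HasCompactSupport g)
    (hα : ∀ x, x < y → w x = α * Real.exp (-|x - y|) ^ n)
    (hβ : ∀ x, y < x → w x = β * Real.exp (-|x - y|) ^ n) :
    ∫ x, g x * w x =
      α * (∫ x in Iic y, g x * Real.exp (n * (x - y))) +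
        β * ∫ x in Ioi y, g x * Real.exp (-n * (x - y)) := by
  have hl : ∀ x ∈ Iio y, α * (g x * Real.exp (n * (x - y))) = g x * w x := fun x hx => by
    rw [hα x hx, exp_neg_abs_pow_of_neg (sub_neg.2 hx)]; ring
  have hr : ∀ x ∈ Ioi y, β * (g x * Real.exp (-n * (x - y))) = g x * w x := fun x hx => by
    rw [hβ x hx, exp_neg_abs_pow_of_pos (sub_pos.2 hx)]; ring
  have il : IntegrableOn (fun x => g x * w x) (Iic y) :=
    (integrableOn_Iic_iff_integrableOn_Iio enorm_ne_top).2 <|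
      (((integrable_mul_exp hg hgc n y).const_mul α).integrableOn).congr_fun hl measurableSet_Iio
  have ir : IntegrableOn (fun x => g x * w x) (Ioi y) :=
    (((integrable_mul_exp hg hgc (-n) y).const_mul β).integrableOn).congr_fun hr measurableSet_Ioi
  rw [← intervalIntegral.integral_Iic_add_Ioi il ir, integral_Iic_eq_integral_Iio,
    ← setIntegral_congr_fun measurableSet_Iio hl, ← setIntegral_congr_fun measurableSet_Ioi hr,
    integral_const_mul, integral_const_mul, ← integral_Iic_eq_integral_Iio]

theorem integral_mul_peakEven_line (hg : Continuous g) (hgc : HasCompactSupport g)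
    (c : ℝ) (n : ℕ) (t : ℝ) :
    ∫ x, g x * peakEven c n (t, x) =
      (∫ x in Iic (c * t), g x * Real.exp (n * (x - c * t))) +
        ∫ x in Ioi (c * t), g x * Real.exp (-n * (x - c * t)) := by
  rw [integral_mul_peak_split (y := c * t) (α := 1) (β := 1) (n := n) hg hgc]
  · ring
  · intro x _; simp [peakEven]
  · intro x _; simp [peakEven]

theorem integral_mul_peakOdd_line (hg : Continuous g) (hgc : HasCompactSupport g)
    (c : ℝ) (n : ℕ) (t : ℝ) :
    ∫ x, g x * peakOdd c n (t, x) =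
      -(∫ x in Iic (c * t), g x * Real.exp (n * (x - c * t))) +
        ∫ x in Ioi (c * t), g x * Real.exp (-n * (x - c * t)) := by
  rw [integral_mul_peak_split (y := c * t) (α := -1) (β := 1) (n := n) hg hgc]
  · ring
  · intro x hx; simp [peakOdd, Real.sign_of_neg (sub_neg.2 hx)]
  · intro x hx; simp [peakOdd, Real.sign_of_pos (sub_pos.2 hx)]

theorem integral_deriv_mul_peakEven_line (hg : ContDiff ℝ 1 g) (hgc : HasCompactSupport g)
    (c : ℝ) (n : ℕ) (t : ℝ) :
    ∫ x, deriv g x * peakEven c n (t, x) = n * ∫ x, g x * peakOdd c n (t, x) := by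
  rw [integral_mul_peakEven_line (hg.continuous_deriv le_rfl) hgc.deriv,
    integral_mul_peakOdd_line hg.continuous hgc,
    integral_Ioi_deriv_mul_exp hg hgc, integral_Iic_deriv_mul_exp hg hgc]
  ring

theorem integral_deriv_mul_peakOdd_line (hg : ContDiff ℝ 1 g) (hgc : HasCompactSupport g)
    (c : ℝ) (n : ℕ) (t : ℝ) :
    ∫ x, deriv g x * peakOdd c n (t, x) =
      -2 * g (c * t) + n * ∫ x, g x * peakEven c n (t, x) := by
  rw [integral_mul_peakOdd_line (hg.continuous_deriv le_rfl) hgc.deriv,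
    integral_mul_peakEven_line hg.continuous hgc,
    integral_Ioi_deriv_mul_exp hg hgc, integral_Iic_deriv_mul_exp hg hgc]
  ring

end Line

section Plane

variable {ψ : ℝ × ℝ → ℝ}

theorem hasCompactSupport_slice (hψc : HasCompactSupport ψ) (t : ℝ) :
    HasCompactSupport fun x => ψ (t, x) :=
  hψc.comp_isClosedEmbedding (g := fun x : ℝ => (t, x)) <| by
    refine Topology.IsClosedEmbedding.of_continuous_injective_isClosedMap (by fun_prop)
      (Prod.mk_right_injective t) ?_
    intro s hs
    have : (fun x : ℝ => (t, x)) '' s = {t} ×ˢ s := by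
      ext ⟨a, b⟩; simp [eq_comm, and_comm]
    rw [this]
    exact isClosed_singleton.prod hs

theorem hasCompactSupport_ray (hψc : HasCompactSupport ψ) (c : ℝ) :
    HasCompactSupport fun t => ψ (t, c * t) := by
  refine HasCompactSupport.intro (hψc.isCompact.image continuous_fst) fun t ht => ?_
  by_contra h
  exact ht ⟨(t, c * t), subset_tsupport _ h, rfl⟩

theorem psix_eq_fderiv (hψ : ContDiff ℝ (⊤ : ℕ∞) ψ) :
    psix ψ = fun p => fderiv ℝ ψ p (0, 1) := by
  ext ⟨t, x⟩
  have h1 := (hψ.differentiable (by simp) (t, x)).hasFDerivAt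
  have h2 : HasDerivAt (fun y : ℝ => (t, y)) (0, 1) x :=
    (hasDerivAt_const x t).prodMk (hasDerivAt_id x)
  exact (h1.comp_hasDerivAt x h2).deriv

theorem contDiff_psix (hψ : ContDiff ℝ (⊤ : ℕ∞) ψ) : ContDiff ℝ (⊤ : ℕ∞) (psix ψ) := by
  rw [psix_eq_fderiv hψ]
  exact (hψ.fderiv_right (by simp)).clm_apply contDiff_const

theorem hasCompactSupport_psix (hψ : ContDiff ℝ (⊤ : ℕ∞) ψ) (hψc : HasCompactSupport ψ) :
    HasCompactSupport (psix ψ) := by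
  rw [psix_eq_fderiv hψ]
  exact hψc.fderiv_apply ℝ _

theorem measurable_real_sign : Measurable Real.sign :=
  Measurable.ite measurableSet_Iio measurable_const
    (Measurable.ite measurableSet_Ioi measurable_const measurable_const)

theorem integrable_mul_peakEven (hψ : Continuous ψ) (hψc : HasCompactSupport ψ) (c : ℝ) (n : ℕ) :
    Integrable fun p => ψ p * peakEven c n p :=
  (hψ.mul (by unfold peakEven; fun_prop)).integrable_of_hasCompactSupport hψc.mul_right

theorem integrable_mul_peakOdd (hψ : Continuous ψ) (hψc : HasCompactSupport ψ) (c : ℝ) (n : ℕ) :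
    Integrable fun p => ψ p * peakOdd c n p := by
  have h := (integrable_mul_peakEven hψ hψc c n).bdd_mul (c := 1)
    (f := fun p : ℝ × ℝ => Real.sign (p.2 - c * p.1))
    (measurable_real_sign.comp (by fun_prop)).aestronglyMeasurable
    (.of_forall fun p => by
      rcases Real.sign_apply_eq (p.2 - c * p.1) with h | h | h <;> simp [h])
  refine h.congr (.of_forall fun p => ?_)
  simp only [peakOdd, peakEven]
  ring

theorem integral_psix_mul_peakEven (hψ : ContDiff ℝ (⊤ : ℕ∞) ψ) (hψc : HasCompactSupport ψ)
    (c : ℝ) (n : ℕ) :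
    ∫ p, psix ψ p * peakEven c n p = n * ∫ p, ψ p * peakOdd c n p := by
  have h1 := integrable_mul_peakEven (contDiff_psix hψ).continuous
    (hasCompactSupport_psix hψ hψc) c n
  have h2 := integrable_mul_peakOdd hψ.continuous hψc c n
  rw [Measure.volume_eq_prod] at h1 h2 ⊢
  rw [integral_prod _ h1, integral_prod _ h2, ← integral_const_mul]
  congr 1 with t
  exact integral_deriv_mul_peakEven_line (g := fun x => ψ (t, x))
    ((hψ.comp (by fun_prop)).of_le (by simp)) (hasCompactSupport_slice hψc t) c n t

theorem integral_psix_mul_peakOdd (hψ : ContDiff ℝ (⊤ : ℕ∞) ψ) (hψc : HasCompactSupport ψ)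
    (c : ℝ) (n : ℕ) :
    ∫ p, psix ψ p * peakOdd c n p =
      -2 * (∫ t, ψ (t, c * t)) + n * ∫ p, ψ p * peakEven c n p := by
  have h1 := integrable_mul_peakOdd (contDiff_psix hψ).continuous
    (hasCompactSupport_psix hψ hψc) c n
  have h2 := integrable_mul_peakEven hψ.continuous hψc c n
  have h3 : Integrable fun t => ψ (t, c * t) :=
    (hψ.continuous.comp (by fun_prop)).integrable_of_hasCompactSupport
      (hasCompactSupport_ray hψc c)
  rw [Measure.volume_eq_prod] at h1 h2 ⊢
  rw [integral_prod _ h1, integral_prod _ h2, ← integral_const_mul, ← integral_const_mul,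
    ← integral_add (h3.const_mul _) (h2.integral_prod_left.const_mul _)]
  congr 1 with t
  exact integral_deriv_mul_peakOdd_line (g := fun x => ψ (t, x))
    ((hψ.comp (by fun_prop)).of_le (by simp)) (hasCompactSupport_slice hψc t) c n t

theorem ae_sub_mul_ne_zero (c : ℝ) : ∀ᵐ p : ℝ × ℝ, p.2 - c * p.1 ≠ 0 := by
  rw [Measure.volume_eq_prod, Measure.ae_prod_iff_ae_ae]
  · refine .of_forall fun t => ?_
    filter_upwards [Measure.ae_ne volume (c * t)] with x hx using sub_ne_zero.2 hx
  · exact (isOpen_ne_fun (by fun_prop) continuous_const).measurableSet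

end Plane

section Phase

variable (φ ω k : ℝ)

theorem psix_Phs (p : ℝ × ℝ) : psix (Phs φ ω k) p = k :=
  ((((hasDerivAt_id p.2).const_mul k).const_add (φ + ω * p.1)).congr_deriv (mul_one k)).deriv

theorem psixx_Phs (p : ℝ × ℝ) : psixx (Phs φ ω k) p = 0 := by
  simp [psixx, psix_Phs]

theorem psit_Phs (p : ℝ × ℝ) : psit (Phs φ ω k) p = ω :=
  (((((hasDerivAt_id p.1).const_mul ω).const_add φ).add_const (k * p.2)).congr_deriv
    (mul_one ω)).deriv

end Phase

section Reduction

variable {ψ : ℝ × ℝ → ℝ}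

theorem psixx_eq (ψ : ℝ × ℝ → ℝ) : psixx ψ = psix (psix ψ) := rfl

theorem integral_amplitude_equation (a c k ω φ : ℝ) (hψ : ContDiff ℝ (⊤ : ℕ∞) ψ)
    (hψc : HasCompactSupport ψ) :
    (∫ p : ℝ × ℝ,
          (psixx ψ p * ((1/6) * (Apkx a c p)^3
               + (1/2) * ((psix (Phs φ ω k) p)^2 - 1) * (Apk a c p)^2 * Apkx a c p
               - Apkt a c p)
           + psix ψ p * ((1/2) * (3 * (psix (Phs φ ω k) p)^2 - 1)
                   * Apk a c p * (Apkx a c p)^2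
               + psix (Phs φ ω k) p * psixx (Phs φ ω k) p * (Apk a c p)^2 * Apkx a c p)
           - ψ p * ((1/2) * (3 * (psix (Phs φ ω k) p)^4
                     - 2 * (psix (Phs φ ω k) p)^2 - 3) * (Apk a c p)^2 * Apkx a c p
               - Apkt a c p
               + (2 * (psix (Phs φ ω k) p)^2 - 1) * psix (Phs φ ω k) p
                   * psixx (Phs φ ω k) p * (Apk a c p)^3)))
      = 2 * (a * c + a^3 * (3 * k^2 - 2) / 6) * (∫ t, psix ψ (t, c * t))
        + a^3 * k^2 * (3 * k^2 / 2 - 1) * ∫ p, ψ p * peakOdd c 3 p := by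
  have h' := contDiff_psix hψ
  have hc' := hasCompactSupport_psix hψ hψc
  have h'' := contDiff_psix h'
  have hc'' := hasCompactSupport_psix h' hc'
  have i1 := (integrable_mul_peakOdd h''.continuous hc'' c 1).const_mul (-(a * c))
  have i2 := (integrable_mul_peakOdd h''.continuous hc'' c 3).const_mul (-a^3 * (3 * k^2 - 2) / 6)
  have i3 := (integrable_mul_peakEven h'.continuous hc' c 3).const_mul (a^3 * (3 * k^2 - 1) / 2)
  have i4 := (integrable_mul_peakOdd hψ.continuous hψc c 1).const_mul (a * c)
  have i5 := (integrable_mul_peakOdd hψ.continuous hψc c 3).const_mul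
    (a^3 * (3 * k^4 - 2 * k^2 - 3) / 2)
  trans ∫ p, (-(a * c) * (psix (psix ψ) p * peakOdd c 1 p)
      + -a^3 * (3 * k^2 - 2) / 6 * (psix (psix ψ) p * peakOdd c 3 p)
      + a^3 * (3 * k^2 - 1) / 2 * (psix ψ p * peakEven c 3 p)
      + a * c * (ψ p * peakOdd c 1 p)
      + a^3 * (3 * k^4 - 2 * k^2 - 3) / 2 * (ψ p * peakOdd c 3 p))
  · refine integral_congr_ae ?_
    filter_upwards [ae_sub_mul_ne_zero c] with p hp
    simp only [psix_Phs, psixx_Phs, psixx_eq ψ, Apk, Apkx, Apkt, peakOdd, peakEven]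
    rcases Real.sign_apply_eq_of_ne_zero _ hp with h | h <;> rw [h] <;> ring
  · rw [integral_add (((i1.fun_add i2).fun_add i3).fun_add i4) i5,
      integral_add ((i1.fun_add i2).fun_add i3) i4, integral_add (i1.fun_add i2) i3,
      integral_add i1 i2]
    simp only [integral_const_mul, integral_psix_mul_peakOdd h' hc',
      integral_psix_mul_peakEven hψ hψc]
    push_cast
    ring

theorem integral_phase_equation (a c k ω φ : ℝ) (hψ : ContDiff ℝ (⊤ : ℕ∞) ψ)
    (hψc : HasCompactSupport ψ) :
    (∫ p : ℝ × ℝ,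
          (psixx ψ p * (Apk a c p * psit (Phs φ ω k) p)
           + psix ψ p * ((5/6) * psix (Phs φ ω k) p * (Apkx a c p)^3
               + (1/2) * psixx (Phs φ ω k) p * Apk a c p * (Apkx a c p)^2
               + (1/2) * ((psix (Phs φ ω k) p)^2 - 3) * psix (Phs φ ω k) p
                   * (Apk a c p)^2 * Apkx a c p
               + (1/2) * ((psix (Phs φ ω k) p)^2 - 1) * psixx (Phs φ ω k) p
                   * (Apk a c p)^3)
           + ψ p * (2 * psix (Phs φ ω k) p * Apk a c p * (Apkx a c p)^2
               + psixx (Phs φ ω k) p * (Apk a c p)^2 * Apkx a c p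
               + ((psix (Phs φ ω k) p)^2 + 1) * (3 - (psix (Phs φ ω k) p)^2)
                   * psix (Phs φ ω k) p * (Apk a c p)^3
               + psit (Phs φ ω k) p * Apk a c p)))
      = -2 * (a * ω + k * a^3 * (2 / 3 - k^2 / 2)) * (∫ t, ψ (t, c * t))
        + 2 * a * ω * (∫ p, ψ p * peakEven c 1 p)
        + k * a^3 * (7 + k^2 / 2 - k^4) * ∫ p, ψ p * peakEven c 3 p := by
  have h' := contDiff_psix hψ
  have hc' := hasCompactSupport_psix hψ hψc
  have h'' := contDiff_psix h'
  have hc'' := hasCompactSupport_psix h' hc'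
  have i1 := (integrable_mul_peakEven h''.continuous hc'' c 1).const_mul (a * ω)
  have i2 := (integrable_mul_peakOdd h'.continuous hc' c 3).const_mul
    (k * a^3 * (2 / 3 - k^2 / 2))
  have i3 := (integrable_mul_peakEven hψ.continuous hψc c 1).const_mul (a * ω)
  have i4 := (integrable_mul_peakEven hψ.continuous hψc c 3).const_mul
    (k * a^3 * (2 + (k^2 + 1) * (3 - k^2)))
  trans ∫ p, (a * ω * (psix (psix ψ) p * peakEven c 1 p)
      + k * a^3 * (2 / 3 - k^2 / 2) * (psix ψ p * peakOdd c 3 p)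
      + a * ω * (ψ p * peakEven c 1 p)
      + k * a^3 * (2 + (k^2 + 1) * (3 - k^2)) * (ψ p * peakEven c 3 p))
  · refine integral_congr_ae ?_
    filter_upwards [ae_sub_mul_ne_zero c] with p hp
    simp only [psix_Phs, psixx_Phs, psit_Phs, psixx_eq ψ, Apk, Apkx, peakOdd, peakEven]
    rcases Real.sign_apply_eq_of_ne_zero _ hp with h | h <;> rw [h] <;> ring
  · rw [integral_add ((i1.fun_add i2).fun_add i3) i4, integral_add (i1.fun_add i2) i3,
      integral_add i1 i2]
    simp only [integral_const_mul, integral_psix_mul_peakOdd hψ hψc,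
      integral_psix_mul_peakEven h' hc']
    push_cast
    ring

end Reduction

section TestFunctions

theorem coeff_eq_zero_of_peakEven {c D₀ D₁ D₃ : ℝ}
    (h : ∀ ψ : ℝ × ℝ → ℝ, ContDiff ℝ (⊤ : ℕ∞) ψ → HasCompactSupport ψ →
      D₀ * (∫ t, ψ (t, c * t)) + D₁ * (∫ p, ψ p * peakEven c 1 p)
        + D₃ * (∫ p, ψ p * peakEven c 3 p) = 0) :
    D₁ = 0 ∧ D₃ = 0 := by
  have hcont : Continuous fun p => D₁ * peakEven c 1 p + D₃ * peakEven c 3 p := by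
    unfold peakEven; fun_prop
  have hU : IsOpen {p : ℝ × ℝ | c * p.1 < p.2} := isOpen_lt (by fun_prop) (by fun_prop)
  have hae := hU.ae_eq_zero_of_integral_contDiff_smul_eq_zero (μ := volume)
    (hcont.locallyIntegrable.locallyIntegrableOn _) fun ψ hψ hψc hsupp => by
      have hray : ∀ t, ψ (t, c * t) = 0 := fun t => by
        by_contra hne
        exact lt_irrefl (c * t) (hsupp (subset_tsupport _ hne))
      have := h ψ hψ hψc
      simp only [hray, integral_zero, mul_zero, zero_add] at this
      rw [← integral_const_mul, ← integral_const_mul,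
        ← integral_add ((integrable_mul_peakEven hψ.continuous hψc c 1).const_mul _)
          ((integrable_mul_peakEven hψ.continuous hψc c 3).const_mul _)] at this
      rw [← this]
      congr 1 with p
      simp only [smul_eq_mul]
      ring
  have hzero := Measure.eqOn_open_of_ae_eq (g := fun _ => (0 : ℝ))
    ((ae_restrict_iff' hU.measurableSet).2 hae) hU hcont.continuousOn continuousOn_const
  have key : ∀ z : ℝ, 0 < z → D₁ * Real.exp (-z) + D₃ * Real.exp (-z) ^ 3 = 0 := fun z hz => by
    have := hzero (x := (0, z)) (by simpa using hz)
    simpa [peakEven, abs_of_pos hz] using this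
  have factor : ∀ z : ℝ, 0 < z → D₁ + D₃ * Real.exp (-z) ^ 2 = 0 := fun z hz => by
    refine (mul_eq_zero.1 (?_ : Real.exp (-z) * _ = 0)).resolve_left (Real.exp_ne_zero _)
    linear_combination key z hz
  have h1 := factor 1 one_pos
  have h2 := factor 2 two_pos
  have hlt : Real.exp (-2) ^ 2 < Real.exp (-1) ^ 2 := by gcongr; norm_num
  have h3 : D₃ = 0 := by
    refine (mul_eq_zero.1 (?_ : D₃ * (Real.exp (-1) ^ 2 - Real.exp (-2) ^ 2) = 0)).resolve_right
      (sub_pos.2 hlt).ne'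
    linear_combination h1 - h2
  exact ⟨by simpa [h3] using h1, h3⟩

theorem exists_integral_ray_ne_zero (c : ℝ) :
    ∃ ψ : ℝ × ℝ → ℝ, ContDiff ℝ (⊤ : ℕ∞) ψ ∧ HasCompactSupport ψ ∧
      ∫ t, ψ (t, c * t) ≠ 0 := by
  let b : ContDiffBump (0 : ℝ × ℝ) := ⟨1, 2, one_pos, one_lt_two⟩
  refine ⟨b, b.contDiff, b.hasCompactSupport, ne_of_gt ?_⟩
  refine Continuous.integral_pos_of_hasCompactSupport_nonneg_nonzero (x := 0)
    (b.continuous.comp (by fun_prop)) (hasCompactSupport_ray b.hasCompactSupport c)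
    (fun t => b.nonneg) ?_
  have h : b ((0 : ℝ), c * 0) = 1 :=
    b.one_of_mem_closedBall (by simp [b])
  exact ne_of_eq_of_ne h one_ne_zero

theorem exists_integral_psix_ray_ne_zero (c : ℝ) :
    ∃ ψ : ℝ × ℝ → ℝ, ContDiff ℝ (⊤ : ℕ∞) ψ ∧ HasCompactSupport ψ ∧
      ∫ t, psix ψ (t, c * t) ≠ 0 := by
  obtain ⟨b, hb, hbc, hne⟩ := exists_integral_ray_ne_zero c
  refine ⟨fun p => (p.2 - c * p.1) * b p, (by fun_prop), hbc.mul_left, ?_⟩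
  convert hne using 3 with t
  have hd : DifferentiableAt ℝ (fun x => b (t, x)) (c * t) :=
    ((hb.comp (by fun_prop : ContDiff ℝ (⊤ : ℕ∞) fun x : ℝ => (t, x))).differentiable
      (by simp)) _
  refine ((((hasDerivAt_id (c * t)).sub_const (c * t)).mul hd.hasDerivAt).congr_deriv ?_).deriv
  simp

end TestFunctions

theorem hirota_peakon_weak_amplitude (a c k ω φ : ℝ) (ha : a ≠ 0) :
    ((∀ ψ₁ : ℝ × ℝ → ℝ, ContDiff ℝ (⊤ : ℕ∞) ψ₁ → HasCompactSupport ψ₁ →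
        (∫ p : ℝ × ℝ,
          (psixx ψ₁ p * ((1/6) * (Apkx a c p)^3
               + (1/2) * ((psix (Phs φ ω k) p)^2 - 1) * (Apk a c p)^2 * Apkx a c p
               - Apkt a c p)
           + psix ψ₁ p * ((1/2) * (3 * (psix (Phs φ ω k) p)^2 - 1)
                   * Apk a c p * (Apkx a c p)^2
               + psix (Phs φ ω k) p * psixx (Phs φ ω k) p * (Apk a c p)^2 * Apkx a c p)
           - ψ₁ p * ((1/2) * (3 * (psix (Phs φ ω k) p)^4
                     - 2 * (psix (Phs φ ω k) p)^2 - 3) * (Apk a c p)^2 * Apkx a c p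
               - Apkt a c p
               + (2 * (psix (Phs φ ω k) p)^2 - 1) * psix (Phs φ ω k) p
                   * psixx (Phs φ ω k) p * (Apk a c p)^3))) = 0) ∧
     (∀ ψ₂ : ℝ × ℝ → ℝ, ContDiff ℝ (⊤ : ℕ∞) ψ₂ → HasCompactSupport ψ₂ →
        (∫ p : ℝ × ℝ,
          (psixx ψ₂ p * (Apk a c p * psit (Phs φ ω k) p)
           + psix ψ₂ p * ((5/6) * psix (Phs φ ω k) p * (Apkx a c p)^3
               + (1/2) * psixx (Phs φ ω k) p * Apk a c p * (Apkx a c p)^2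
               + (1/2) * ((psix (Phs φ ω k) p)^2 - 3) * psix (Phs φ ω k) p
                   * (Apk a c p)^2 * Apkx a c p
               + (1/2) * ((psix (Phs φ ω k) p)^2 - 1) * psixx (Phs φ ω k) p
                   * (Apk a c p)^3)
           + ψ₂ p * (2 * psix (Phs φ ω k) p * Apk a c p * (Apkx a c p)^2
               + psixx (Phs φ ω k) p * (Apk a c p)^2 * Apkx a c p
               + ((psix (Phs φ ω k) p)^2 + 1) * (3 - (psix (Phs φ ω k) p)^2)
                   * psix (Phs φ ω k) p * (Apk a c p)^3
               + psit (Phs φ ω k) p * Apk a c p))) = 0))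
    ↔ (k = 0 ∧ ω = 0 ∧ c = (1/3) * a^2) := by
  have hamp : ∀ ψ : ℝ × ℝ → ℝ, ∀ hψ : ContDiff ℝ (⊤ : ℕ∞) ψ, ∀ hψc : HasCompactSupport ψ, _ :=
    fun ψ hψ hψc => integral_amplitude_equation a c k ω φ hψ hψc
  have hph : ∀ ψ : ℝ × ℝ → ℝ, ∀ hψ : ContDiff ℝ (⊤ : ℕ∞) ψ, ∀ hψc : HasCompactSupport ψ, _ :=
    fun ψ hψ hψc => integral_phase_equation a c k ω φ hψ hψc
  constructor
  · rintro ⟨h1, h2⟩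
    have h2' := fun ψ hψ hψc => (hph ψ hψ hψc).symm.trans (h2 ψ hψ hψc)
    obtain ⟨hD1, hD3⟩ := coeff_eq_zero_of_peakEven h2'
    have hω : ω = 0 := by simpa [ha] using hD1
    have hk : k = 0 := by
      obtain ⟨ψ, hψ, hψc, hne⟩ := exists_integral_ray_ne_zero c
      have h0 := h2' ψ hψ hψc
      rw [hD1, hD3, zero_mul, zero_mul, add_zero, add_zero] at h0
      have h0 := (mul_eq_zero.1 h0).resolve_right hne
      by_contra hk
      have hka : k * a^3 ≠ 0 := mul_ne_zero hk (pow_ne_zero 3 ha)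
      have e1 : k^2 = 4 / 3 := by
        have : k * a^3 * (2 / 3 - k^2 / 2) = 0 := by rw [hω] at h0; linarith
        have := (mul_eq_zero.1 this).resolve_left hka
        linarith
      have e2 := (mul_eq_zero.1 hD3).resolve_left hka
      have e3 : k^4 = (4 / 3)^2 := by rw [← e1]; ring
      rw [e1, e3] at e2
      norm_num at e2
    refine ⟨hk, hω, ?_⟩
    obtain ⟨ψ, hψ, hψc, hne⟩ := exists_integral_psix_ray_ne_zero c
    have h0 := (hamp ψ hψ hψc).symm.trans (h1 ψ hψ hψc)
    subst hk
    have h0 : 2 * (a * c + a^3 * (3 * 0^2 - 2) / 6) = 0 :=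
      (mul_eq_zero.1 (by simpa using h0)).resolve_right hne
    apply mul_left_cancel₀ ha
    linarith
  · rintro ⟨hk, hω, hc⟩
    refine ⟨fun ψ hψ hψc => (hamp ψ hψ hψc).trans ?_, fun ψ hψ hψc => (hph ψ hψ hψc).trans ?_⟩
    · have : a * c + a^3 * (3 * k^2 - 2) / 6 = 0 := by rw [hk, hc]; ring
      rw [this, hk]
      ring
    · rw [hk, hω]
      ring
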